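/- arXiv:2408.00876 — 2 statements merged into one kernel-verified Lean document; each statement's English description precedes it below -/
import Mathlib

section
/- For every ε with 0 < ε < 1/4 there exists d₀ ∈ ℕ such that for all d ≥ d₀, for every subset A ⊆ {0,…,d−1} with d/3 ≤ |A| ≤ d/2 and B its complement, setting M = ⌈2^{(1/4−ε)·d}⌉, there exist M pairwise distinct assignments x_0, …, x_{M−1} : A → {0,1} and M pairwise distinct assignments y_0, …, y_{M−1} : B → {0,1} such that the numbers p_i := ι_A(x_i) + ι_B(y_i) + 1 (for 0 ≤ i ≤ M−1) are pairwise distinct primes, and for all indices 0 ≤ i, j, k ≤ M−1, if ι_A(x_j) + ι_B(y_k) + 1 = p_i then i = j = k. -/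
/-- The encoding ι_A(x) = ∑_{i∈A} 2^i · x(i) of an assignment x : A → {0,1}. -/
def enc (A : Finset ℕ) (x : A → Fin 2) : ℕ := ∑ i : A, 2 ^ (i : ℕ) * (x i : ℕ)

/-- A bipartite graph on `α` and `β` with more than `m * (|α| + |β|)` edges contains a
matching with `m` edges. -/
theorem exists_matching {α β : Type*} [Fintype α] [Fintype β] [DecidableEq α] [DecidableEq β]
    (E : Finset (α × β)) (m : ℕ) (h : m * (Fintype.card α + Fintype.card β) < E.card) :
    ∃ f : Fin m → α × β, (Function.Injective fun i => (f i).1) ∧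
      (Function.Injective fun i => (f i).2) ∧ ∀ i, f i ∈ E := by
  induction m with
  | zero => exact ⟨Fin.elim0, fun i => i.elim0, fun i => i.elim0, fun i => i.elim0⟩
  | succ m ih =>
    obtain ⟨f, hf₁, hf₂, hfE⟩ := ih (lt_of_le_of_lt (Nat.mul_le_mul_right _ m.le_succ) h)
    let covered : Finset (α × β) :=
      (Finset.univ.image fun i => (f i).1) ×ˢ Finset.univ ∪
        Finset.univ ×ˢ (Finset.univ.image fun i => (f i).2)
    have hcard : covered.card < E.card := by
      refine lt_of_le_of_lt (Finset.card_union_le _ _) (lt_of_le_of_lt ?_ h)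
      rw [Finset.card_product, Finset.card_product, Finset.card_image_of_injective _ hf₁,
        Finset.card_image_of_injective _ hf₂]
      simp only [Finset.card_univ, Fintype.card_fin]
      nlinarith
    obtain ⟨e, heE, he⟩ := Finset.exists_mem_notMem_of_card_lt_card hcard
    simp only [covered, Finset.mem_union, Finset.mem_product, Finset.mem_image, Finset.mem_univ,
      true_and, and_true, not_or, not_exists] at he
    refine ⟨Fin.cons e f, ?_, ?_, ?_⟩
    · intro i j
      refine Fin.cases ?_ (fun i => ?_) i <;> refine Fin.cases ?_ (fun j => ?_) j
      · simp
      · intro hij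
        exact absurd hij.symm (he.1 j)
      · intro hij
        exact absurd hij (he.1 i)
      · intro hij
        exact congrArg Fin.succ (hf₁ hij)
    · intro i j
      refine Fin.cases ?_ (fun i => ?_) i <;> refine Fin.cases ?_ (fun j => ?_) j
      · simp
      · intro hij
        exact absurd hij.symm (he.2 j)
      · intro hij
        exact absurd hij (he.2 i)
      · intro hij
        exact congrArg Fin.succ (hf₂ hij)
    · exact Fin.cases heE hfE

theorem exists_binary_digits (d n : ℕ) (hn : n < 2 ^ d) :
    ∃ z : ℕ → Fin 2, ∑ i ∈ Finset.range d, 2 ^ i * (z i : ℕ) = n := by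
  induction d generalizing n with
  | zero => exact ⟨0, by simp at hn; simp [hn]⟩
  | succ d ih =>
    obtain ⟨z, hz⟩ := ih (n / 2) (by rw [pow_succ] at hn; omega)
    refine ⟨fun i => Nat.casesOn i ⟨n % 2, Nat.mod_lt _ two_pos⟩ z, ?_⟩
    rw [Finset.sum_range_succ']
    simp only [pow_succ', mul_assoc, ← Finset.mul_sum, hz, pow_zero, one_mul]
    exact Nat.div_add_mod n 2

theorem eq_of_sum_two_pow_mul_eq (d : ℕ) (z w : ℕ → Fin 2)
    (h : ∑ i ∈ Finset.range d, 2 ^ i * (z i : ℕ) = ∑ i ∈ Finset.range d, 2 ^ i * (w i : ℕ)) :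
    ∀ i < d, z i = w i := by
  induction d generalizing z w with
  | zero => simp
  | succ d ih =>
    rw [Finset.sum_range_succ', Finset.sum_range_succ'] at h
    simp only [pow_succ', mul_assoc, ← Finset.mul_sum, pow_zero, one_mul] at h
    have hz := (z 0).isLt
    have hw := (w 0).isLt
    have htail := ih (fun i => z (i + 1)) (fun i => w (i + 1)) (by omega)
    rintro (_ | i) hi
    · exact Fin.ext (by omega)
    · exact htail i (by omega)

theorem enc_restrict (A : Finset ℕ) (z : ℕ → Fin 2) :
    enc A (fun i => z i) = ∑ i ∈ A, 2 ^ i * (z i : ℕ) :=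
  Finset.sum_coe_sort A fun i => 2 ^ i * (z i : ℕ)

theorem enc_add_enc_sdiff_restrict {A : Finset ℕ} {d : ℕ} (hA : A ⊆ Finset.range d)
    (z : ℕ → Fin 2) :
    enc A (fun i => z i) + enc (Finset.range d \ A) (fun i => z i) =
      ∑ i ∈ Finset.range d, 2 ^ i * (z i : ℕ) := by
  rw [enc_restrict, enc_restrict, add_comm, Finset.sum_sdiff hA]

theorem exists_common_extension {A B : Finset ℕ} (hAB : Disjoint A B) (x : A → Fin 2)
    (y : B → Fin 2) : ∃ z : ℕ → Fin 2, (fun i : A => z i) = x ∧ (fun i : B => z i) = y := by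
  refine ⟨fun i => if h : i ∈ A then x ⟨i, h⟩ else if h : i ∈ B then y ⟨i, h⟩ else 0, ?_, ?_⟩
  · ext i
    simp
  · ext i
    simp [Finset.disjoint_right.mp hAB i.2]

theorem enc_add_enc_sdiff_injective {A : Finset ℕ} {d : ℕ} (hA : A ⊆ Finset.range d)
    {x x' : A → Fin 2} {y y' : ↥(Finset.range d \ A) → Fin 2}
    (h : enc A x + enc (Finset.range d \ A) y = enc A x' + enc (Finset.range d \ A) y') :
    x = x' ∧ y = y' := by
  obtain ⟨z, rfl, rfl⟩ := exists_common_extension Finset.disjoint_sdiff x y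
  obtain ⟨w, rfl, rfl⟩ := exists_common_extension Finset.disjoint_sdiff x' y'
  rw [enc_add_enc_sdiff_restrict hA, enc_add_enc_sdiff_restrict hA] at h
  have hzw := eq_of_sum_two_pow_mul_eq d z w h
  exact ⟨funext fun i => hzw i (Finset.mem_range.mp (hA i.2)),
    funext fun i => hzw i (Finset.mem_range.mp (Finset.sdiff_subset i.2))⟩

theorem primeCounting_two_pow_le_card {A : Finset ℕ} {d : ℕ} (hA : A ⊆ Finset.range d) :
    Nat.primeCounting (2 ^ d) ≤
      (Finset.univ.filter fun p : (A → Fin 2) × (↥(Finset.range d \ A) → Fin 2) =>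
        (enc A p.1 + enc (Finset.range d \ A) p.2 + 1).Prime).card := by
  rw [← Nat.primesLE_card_eq_primeCounting]
  refine Finset.card_le_card_of_surjOn
    (fun p => enc A p.1 + enc (Finset.range d \ A) p.2 + 1) fun n hn => ?_
  obtain ⟨hle, hprime⟩ := Nat.mem_primesLE.mp hn
  have hpos := hprime.pos
  obtain ⟨z, hz⟩ := exists_binary_digits d (n - 1) (by omega)
  have hsum : enc A (fun i => z i) + enc (Finset.range d \ A) (fun i => z i) + 1 = n := by
    rw [enc_add_enc_sdiff_restrict hA, hz]
    omega
  exact ⟨(fun i => z i, fun i => z i), by simpa [hsum] using hprime, hsum⟩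

theorem eventually_mul_lt_primeCounting_two_pow :
    ∀ᶠ d : ℕ in Filter.atTop,
      4 * (2 : ℝ) ^ ((11 / 12 : ℝ) * d) < Nat.primeCounting (2 ^ d) := by
  have hr : 1 < (2 : ℝ) ^ (1 / 12 : ℝ) := Real.one_lt_rpow one_lt_two (by norm_num)
  have hlim := tendsto_pow_const_div_const_pow_of_one_lt 1 hr
  filter_upwards [hlim.eventually_lt_const (show (0 : ℝ) < 1 / 6 by norm_num),
    Filter.eventually_ge_atTop 1] with d hd hd1
  have hd1' : (1 : ℝ) ≤ d := by exact_mod_cast hd1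
  have hd0 : (0 : ℝ) < d := by linarith
  rw [pow_one, div_lt_iff₀ (by positivity), ← Real.rpow_natCast, ← Real.rpow_mul two_pos.le] at hd
  have hlog2 : 0 < Real.log 2 := Real.log_pos one_lt_two
  have hsplit : (2 : ℝ) ^ d = 2 ^ ((11 / 12 : ℝ) * d) * 2 ^ ((1 / 12 : ℝ) * d) := by
    rw [← Real.rpow_add two_pos, ← Real.rpow_natCast]
    congr 1
    ring
  have hone : (1 : ℝ) ≤ 2 ^ ((11 / 12 : ℝ) * d) :=
    Real.one_le_rpow one_le_two (by positivity)
  have hlog : Real.log ((2 : ℝ) ^ d + 1) ≤ (d + 1) * Real.log 2 := by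
    have : Real.log ((2 : ℝ) ^ d + 1) ≤ Real.log ((2 : ℝ) ^ (d + 1)) := by
      apply Real.log_le_log (by positivity)
      rw [pow_succ]
      linarith [one_le_pow₀ (n := d) (one_le_two (α := ℝ))]
    simpa using this
  have hpi := Chebyshev.pi_ge (2 ^ d)
  push_cast at hpi
  refine lt_of_lt_of_le ?_ hpi
  rw [Real.log_pow, lt_div_iff₀ (by positivity)]
  have hmain : 4 * (2 : ℝ) ^ ((11 / 12 : ℝ) * d) * d + (d + 1) < 2 ^ d := by
    rw [hsplit]
    nlinarith
  nlinarith

theorem ceil_two_rpow_mul_le {ε : ℝ} (hε : 0 < ε) (hε' : ε < 1 / 4) {a b d : ℕ}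
    (ha : (a : ℝ) ≤ 2 / 3 * d) (hb : (b : ℝ) ≤ 2 / 3 * d) :
    ((⌈(2 : ℝ) ^ ((1 / 4 - ε) * d)⌉₊ * (2 ^ a + 2 ^ b) : ℕ) : ℝ) ≤
      4 * (2 : ℝ) ^ ((11 / 12 : ℝ) * d) := by
  have hd0 : (0 : ℝ) ≤ d := d.cast_nonneg
  have hpow : ∀ c : ℕ, (c : ℝ) ≤ 2 / 3 * d → (2 : ℝ) ^ c ≤ 2 ^ ((2 / 3 : ℝ) * d) := fun c hc => by
    rw [← Real.rpow_natCast]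
    exact Real.rpow_le_rpow_of_exponent_le one_le_two hc
  have hone : (1 : ℝ) ≤ 2 ^ ((1 / 4 - ε) * d) :=
    Real.one_le_rpow one_le_two (mul_nonneg (by linarith) hd0)
  have hle : (2 : ℝ) ^ ((1 / 4 - ε) * d) ≤ 2 ^ ((1 / 4 : ℝ) * d) :=
    Real.rpow_le_rpow_of_exponent_le one_le_two (by nlinarith)
  have hceil := Nat.ceil_lt_add_one (zero_le_one.trans hone)
  have hsplit : (2 : ℝ) ^ ((11 / 12 : ℝ) * d) = 2 ^ ((1 / 4 : ℝ) * d) * 2 ^ ((2 / 3 : ℝ) * d) := by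
    rw [← Real.rpow_add two_pos]
    congr 1
    ring
  push_cast
  calc _ ≤ (2 * (2 : ℝ) ^ ((1 / 4 : ℝ) * d)) * (2 * 2 ^ ((2 / 3 : ℝ) * d)) :=
        mul_le_mul (by linarith) (by linarith [hpow a ha, hpow b hb]) (by positivity)
          (by positivity)
    _ = _ := by rw [hsplit]; ring


/-- for 0 < ε < 1/4 and sufficiently large d, for any A ⊆ {0,…,d−1} with
d/3 ≤ |A| ≤ d/2 and B its complement, with M = ⌈2^{(1/4−ε)d}⌉, there are M pairwise
distinct assignments x_i of A and M pairwise distinct assignments y_i of B such that the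
p_i := ι_A(x_i) + ι_B(y_i) + 1 are pairwise distinct primes and
ι_A(x_j) + ι_B(y_k) + 1 = p_i only if i = j = k. -/
theorem stmt_3 :
    ∀ ε : ℝ, 0 < ε → ε < 1/4 →
    ∃ d₀ : ℕ, ∀ d : ℕ, d₀ ≤ d →
    ∀ A : Finset ℕ, A ⊆ Finset.range d →
      (d : ℝ) / 3 ≤ (A.card : ℝ) → (A.card : ℝ) ≤ (d : ℝ) / 2 →
    ∀ B : Finset ℕ, B = Finset.range d \ A →
    ∀ M : ℕ, M = ⌈(2 : ℝ) ^ ((1/4 - ε) * d)⌉₊ →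
    ∃ x : Fin M → (A → Fin 2), ∃ y : Fin M → (B → Fin 2),
      Function.Injective x ∧ Function.Injective y ∧
      (∀ i : Fin M, Nat.Prime (enc A (x i) + enc B (y i) + 1)) ∧
      Function.Injective (fun i : Fin M => enc A (x i) + enc B (y i) + 1) ∧
      ∀ i j k : Fin M,
        enc A (x j) + enc B (y k) + 1 = enc A (x i) + enc B (y i) + 1 →
        i = j ∧ j = k := by
  intro ε hε hε'
  obtain ⟨d₀, hd₀⟩ := Filter.eventually_atTop.mp eventually_mul_lt_primeCounting_two_pow
  refine ⟨d₀, fun d hd A hA hlo hhi B hB M hM => ?_⟩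
  subst hB hM
  have hcard : ((Finset.range d \ A).card : ℝ) = d - A.card := by
    rw [Finset.cast_card_sdiff hA, Finset.card_range]
  have hd0 : (0 : ℝ) ≤ d := d.cast_nonneg
  have hlt : ⌈(2 : ℝ) ^ ((1 / 4 - ε) * d)⌉₊ * (2 ^ A.card + 2 ^ (Finset.range d \ A).card) <
      Nat.primeCounting (2 ^ d) := by
    exact_mod_cast (ceil_two_rpow_mul_le hε hε' (by linarith) (by linarith)).trans_lt (hd₀ d hd)
  obtain ⟨f, hf₁, hf₂, hf⟩ := exists_matching _ ⌈(2 : ℝ) ^ ((1 / 4 - ε) * d)⌉₊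
    (lt_of_lt_of_le (by simpa using hlt) (primeCounting_two_pow_le_card hA))
  refine ⟨fun i => (f i).1, fun i => (f i).2, hf₁, hf₂,
    fun i => (Finset.mem_filter.mp (hf i)).2, fun i j hij => ?_, fun i j k h => ?_⟩
  · exact hf₁ (enc_add_enc_sdiff_injective hA (Nat.succ_injective hij)).1
  · obtain ⟨h₁, h₂⟩ := enc_add_enc_sdiff_injective hA (Nat.succ_injective h)
    have hji := hf₁ h₁
    have hki := hf₂ h₂
    exact ⟨hji.symm, hji.trans hki.symm⟩
end

section
/- For every ε with 0 < ε < 1/4 there exists d₀ ∈ ℕ such that for all d ≥ d₀ the following holds. Let A ⊆ {0,…,d−1} be any subset with d/3 ≤ |A| ≤ 2d/3 and let B be its complement. Let F be any real-valued function on pairs (x, y), where x : A → {0,1} and y : B → {0,1}, satisfying F(x, y)² = ι_A(x) + ι_B(y) + 1 for all such pairs. Then the real matrix indexed by assignments of A (rows) and assignments of B (columns) with (x, y) entry F(x, y) has rank at least 2^{(1/4−ε)·d} over ℝ. -/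
/-- A subfield of `ℝ` contains no square root of a natural number of odd `p`-adic valuation. -/
def AvoidsOddSqrt (p : ℕ) (K : Subfield ℝ) : Prop :=
  ∀ n : ℕ, Odd (padicValNat p n) → ∀ x ∈ K, x ^ 2 ≠ n

theorem avoidsOddSqrt_ratCast (p : ℕ) [Fact p.Prime] :
    AvoidsOddSqrt p (Rat.castHom ℝ).fieldRange := by
  rintro n hn _ ⟨q, rfl⟩ h
  have hq : q ^ 2 = n := by
    have h' : (q : ℝ) ^ 2 = n := by simpa using h
    exact_mod_cast h'
  have hn0 : n ≠ 0 := by rintro rfl; simp at hn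
  have hq0 : q ≠ 0 := by
    rintro rfl
    apply hn0
    have : (n : ℚ) = 0 := by rw [← hq]; simp
    exact_mod_cast this
  have hval := congrArg (padicValRat p) hq
  rw [padicValRat.pow, padicValRat.of_nat] at hval
  rcases hn with ⟨k, hk⟩
  rw [hk] at hval
  push_cast at hval
  omega

/-- The subfield `K(s)` for `s` with `s ^ 2 ∈ K`. -/
def adjoinSqrt (K : Subfield ℝ) (s : ℝ) (hs : s ^ 2 ∈ K) : Subfield ℝ where
  carrier := {x | ∃ a ∈ K, ∃ b ∈ K, x = a + b * s}
  mul_mem' := by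
    rintro _ _ ⟨a, ha, b, hb, rfl⟩ ⟨c, hc, d, hd, rfl⟩
    exact ⟨a * c + b * d * s ^ 2, add_mem (mul_mem ha hc) (mul_mem (mul_mem hb hd) hs),
      a * d + b * c, add_mem (mul_mem ha hd) (mul_mem hb hc), by ring⟩
  one_mem' := ⟨1, one_mem K, 0, zero_mem K, by ring⟩
  add_mem' := by
    rintro _ _ ⟨a, ha, b, hb, rfl⟩ ⟨c, hc, d, hd, rfl⟩
    exact ⟨a + c, add_mem ha hc, b + d, add_mem hb hd, by ring⟩
  zero_mem' := ⟨0, zero_mem K, 0, zero_mem K, by ring⟩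
  neg_mem' := by
    rintro _ ⟨a, ha, b, hb, rfl⟩
    exact ⟨-a, neg_mem ha, -b, neg_mem hb, by ring⟩
  inv_mem' := by
    rintro _ ⟨a, ha, b, hb, rfl⟩
    by_cases h₁ : a + b * s = 0
    · exact ⟨0, zero_mem K, 0, zero_mem K, by simp [h₁]⟩
    by_cases h₂ : a - b * s = 0
    · refine ⟨(2 * a)⁻¹, inv_mem (mul_mem (ofNat_mem K 2) ha), 0, zero_mem K, ?_⟩
      rw [show a + b * s = 2 * a by linarith]
      ring
    have hD : a ^ 2 - b ^ 2 * s ^ 2 ∈ K :=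
      sub_mem (pow_mem ha 2) (mul_mem (pow_mem hb 2) hs)
    refine ⟨a / (a ^ 2 - b ^ 2 * s ^ 2), div_mem ha hD,
      -b / (a ^ 2 - b ^ 2 * s ^ 2), div_mem (neg_mem hb) hD, ?_⟩
    have hfac : a ^ 2 - b ^ 2 * s ^ 2 = (a + b * s) * (a - b * s) := by ring
    rw [hfac]
    field_simp
    ring

theorem AvoidsOddSqrt.adjoinSqrt {p : ℕ} [Fact p.Prime] {K : Subfield ℝ}
    (hK : AvoidsOddSqrt p K) {s : ℝ} {q : ℕ} (hsq : s ^ 2 = q) (hq : ¬ p ∣ q)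
    (hs : s ^ 2 ∈ K) : AvoidsOddSqrt p (adjoinSqrt K s hs) := by
  rintro n hn _ ⟨a, ha, b, hb, rfl⟩ hx
  have hq0 : q ≠ 0 := by rintro rfl; simp at hq
  have hn0 : n ≠ 0 := by rintro rfl; simp at hn
  by_cases hb0 : b = 0
  · exact hK n hn a ha (by simpa [hb0] using hx)
  by_cases ha0 : a = 0
  · refine hK (n * q) ?_ (b * s ^ 2) (mul_mem hb hs) ?_
    · rwa [padicValNat.mul hn0 hq0, padicValNat.eq_zero_of_not_dvd hq, add_zero]
    · rw [ha0] at hx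
      push_cast
      rw [← hx, ← hsq]
      ring
  · have hsK : s ∈ K := by
      have : s = (n - a ^ 2 - b ^ 2 * s ^ 2) / (2 * a * b) := by
        rw [← hx]
        field_simp
        ring
      rw [this]
      exact div_mem (sub_mem (sub_mem (natCast_mem K n) (pow_mem ha 2))
        (mul_mem (pow_mem hb 2) hs)) (mul_mem (mul_mem (ofNat_mem K 2) ha) hb)
    exact hK n hn _ (add_mem ha (mul_mem hb hsK)) hx

theorem exists_avoidsOddSqrt_of_finset (p : ℕ) [Fact p.Prime] (S : Finset ℝ)
    (hS : ∀ s ∈ S, ∃ q : ℕ, ¬ p ∣ q ∧ s ^ 2 = q) :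
    ∃ K : Subfield ℝ, AvoidsOddSqrt p K ∧ ∀ s ∈ S, s ∈ K := by
  induction S using Finset.induction_on with
  | empty => exact ⟨_, avoidsOddSqrt_ratCast p, by simp⟩
  | insert s S _ ih =>
    obtain ⟨K, hK, hSK⟩ := ih fun t ht => hS t (Finset.mem_insert_of_mem ht)
    obtain ⟨q, hq, hsq⟩ := hS s (Finset.mem_insert_self s S)
    have hs : s ^ 2 ∈ K := hsq ▸ natCast_mem K q
    refine ⟨_, hK.adjoinSqrt hsq hq hs, fun t ht => ?_⟩
    rcases Finset.mem_insert.1 ht with rfl | ht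
    · exact ⟨0, zero_mem K, 1, one_mem K, by ring⟩
    · exact ⟨t, hSK t ht, 0, zero_mem K, by ring⟩

theorem det_mem_subfield {r : ℕ} (K : Subfield ℝ) (M : Matrix (Fin r) (Fin r) ℝ)
    (hM : ∀ i j, M i j ∈ K) : M.det ∈ K := by
  rw [Matrix.det_apply]
  exact sum_mem fun σ _ => zsmul_mem (prod_mem fun i _ => hM _ _) _

/-- A matrix of square roots of natural numbers is nonsingular if the radicands on the diagonal
are primes that divide no other radicand. -/
theorem det_ne_zero_of_sq_eq_natCast {r : ℕ} (M : Matrix (Fin r) (Fin r) ℝ)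
    (N : Fin r → Fin r → ℕ) (hM : ∀ i j, M i j ^ 2 = N i j) (hp : ∀ i, (N i i).Prime)
    (hN : ∀ i j k, N i i ∣ N j k → j = i ∧ k = i) : M.det ≠ 0 := by
  induction r with
  | zero => simp
  | succ r ih =>
    have : Fact (N 0 0).Prime := ⟨hp 0⟩
    let S : Finset ℝ := (Finset.univ.filter
      fun jk : Fin (r + 1) × Fin (r + 1) => jk ≠ (0, 0)).image fun jk => M jk.1 jk.2
    obtain ⟨K, hK, hSK⟩ := exists_avoidsOddSqrt_of_finset (N 0 0) S (by
      intro s hs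
      obtain ⟨⟨j, k⟩, hjk, rfl⟩ := Finset.mem_image.1 hs
      refine ⟨N j k, fun h => ?_, hM j k⟩
      obtain ⟨rfl, rfl⟩ := hN 0 j k h
      simp at hjk)
    have hMK : ∀ j k, (j, k) ≠ (0, 0) → M j k ∈ K := fun j k hjk =>
      hSK _ (Finset.mem_image.2 ⟨(j, k), by simpa using hjk, rfl⟩)
    have hminor : ∀ k : Fin (r + 1), (M.submatrix Fin.succ k.succAbove).det ∈ K := fun k =>
      det_mem_subfield K _ fun i j => hMK _ _ (by simp [Fin.succ_ne_zero])
    have hC := ih (M.submatrix Fin.succ Fin.succ) (fun i j => N i.succ j.succ)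
      (fun i j => hM _ _) (fun i => hp _) (fun i j k h => by simpa using hN _ _ _ h)
    intro h0
    rw [Matrix.det_succ_row_zero, Fin.sum_univ_succ] at h0
    have hrest : ∑ i : Fin r, (-1 : ℝ) ^ (i.succ : ℕ) * M 0 i.succ *
        (M.submatrix Fin.succ i.succ.succAbove).det ∈ K :=
      sum_mem fun i _ => mul_mem (mul_mem (pow_mem (neg_mem (one_mem K)) _)
        (hMK _ _ (by simp [Fin.succ_ne_zero]))) (hminor _)
    have hC' : (M.submatrix Fin.succ (Fin.succAbove 0)).det ≠ 0 := by
      simpa [Fin.succAbove_zero] using hC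
    refine hK (N 0 0) (by simp) (M 0 0) ?_ (hM 0 0)
    have : M 0 0 = -(∑ i : Fin r, (-1 : ℝ) ^ (i.succ : ℕ) * M 0 i.succ *
        (M.submatrix Fin.succ i.succ.succAbove).det) /
        (M.submatrix Fin.succ (Fin.succAbove 0)).det := by
      rw [eq_div_iff hC']
      simp only [Fin.val_zero, pow_zero, one_mul] at h0
      linarith
    rw [this]
    exact div_mem (neg_mem hrest) (hminor 0)

/-- A finite set of cells contains a partial matching of size at least its cardinality divided by
the semiperimeter of the grid. -/
theorem exists_matching_s11 {α β : Type*} [Fintype α] [Fintype β] [DecidableEq α] [DecidableEq β]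
    (P : Finset (α × β)) :
    ∃ T ⊆ P, (∀ s ∈ T, ∀ t ∈ T, s.1 = t.1 ∨ s.2 = t.2 → s = t) ∧
      P.card ≤ T.card * (Fintype.card α + Fintype.card β) := by
  let 𝒯 := P.powerset.filter fun T => ∀ s ∈ T, ∀ t ∈ T, s.1 = t.1 ∨ s.2 = t.2 → s = t
  obtain ⟨T, hT, hmax⟩ := 𝒯.exists_max_image Finset.card ⟨∅, by simp [𝒯]⟩
  simp only [𝒯, Finset.mem_filter, Finset.mem_powerset] at hT hmax
  refine ⟨T, hT.1, hT.2, ?_⟩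
  have hcover : P ⊆ T.biUnion fun t =>
      (Finset.univ.image fun a => (a, t.2)) ∪ Finset.univ.image fun b => (t.1, b) := by
    intro c hc
    by_contra hcT
    have hfree : ∀ t ∈ T, c.1 ≠ t.1 ∧ c.2 ≠ t.2 := by
      intro t ht
      constructor
      · intro h
        exact hcT (Finset.mem_biUnion.2 ⟨t, ht, Finset.mem_union_right _
          (Finset.mem_image.2 ⟨c.2, Finset.mem_univ _, by rw [← h]⟩)⟩)
      · intro h
        exact hcT (Finset.mem_biUnion.2 ⟨t, ht, Finset.mem_union_left _
          (Finset.mem_image.2 ⟨c.1, Finset.mem_univ _, by rw [← h]⟩)⟩)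
    have hcnot : c ∉ T := fun h => (hfree c h).1 rfl
    have := hmax (insert c T) ⟨Finset.insert_subset hc hT.1, by
      intro s hs t ht hst
      rcases Finset.mem_insert.1 hs with rfl | hs <;> rcases Finset.mem_insert.1 ht with rfl | ht
      · rfl
      · have := hfree t ht; tauto
      · have := hfree s (by assumption)
        rcases hst with h | h
        · exact absurd h.symm this.1
        · exact absurd h.symm this.2
      · exact hT.2 s hs t ht hst⟩
    rw [Finset.card_insert_of_notMem hcnot] at this
    omega
  refine (Finset.card_le_card hcover).trans (Finset.card_biUnion_le_card_mul _ _ _ fun t _ => ?_)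
  exact (Finset.card_union_le _ _).trans (add_le_add Finset.card_image_le Finset.card_image_le)

theorem enc_le (A : Finset ℕ) (x : A → Fin 2) : enc A x ≤ ∑ i ∈ A, 2 ^ i := by
  rw [enc, ← Finset.sum_coe_sort A]
  exact Finset.sum_le_sum fun i _ => by
    simpa using Nat.mul_le_mul_left (2 ^ (i : ℕ)) (show (x i : ℕ) ≤ 1 by omega)

theorem enc_testBit (A : Finset ℕ) (n : ℕ) :
    enc A (fun i => if n.testBit i then 1 else 0) =
      ∑ i ∈ A, if n.testBit i then 2 ^ i else 0 := by
  rw [enc, ← Finset.sum_coe_sort A]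
  exact Finset.sum_congr rfl fun i _ => by split_ifs <;> simp

theorem even_enc_of_zero_notMem {A : Finset ℕ} (hA : 0 ∉ A) (x : A → Fin 2) : Even (enc A x) := by
  rw [even_iff_two_dvd]
  refine Finset.dvd_sum fun i _ => Dvd.dvd.mul_right (dvd_pow_self 2 ?_) _
  rintro h
  exact hA (h ▸ i.2)

theorem enc_add_enc_lt {d : ℕ} {A : Finset ℕ} (hA : A ⊆ Finset.range d)
    (x : A → Fin 2) (y : ↥(Finset.range d \ A) → Fin 2) :
    enc A x + enc (Finset.range d \ A) y < 2 ^ d := by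
  have h := Finset.sum_sdiff hA (f := fun i => 2 ^ i)
  have := Nat.geomSum_lt le_rfl (s := Finset.range d) (n := d) fun k hk => Finset.mem_range.1 hk
  have := enc_le A x
  have := enc_le _ y
  omega

theorem exists_enc_add_enc_eq {d : ℕ} {A : Finset ℕ} (hA : A ⊆ Finset.range d) {n : ℕ}
    (hn : n < 2 ^ d) :
    ∃ (x : A → Fin 2) (y : ↥(Finset.range d \ A) → Fin 2),
      enc A x + enc (Finset.range d \ A) y = n := by
  refine ⟨_, _, (congrArg₂ (· + ·) (enc_testBit A n) (enc_testBit _ n)).trans ?_⟩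
  rw [add_comm, Finset.sum_sdiff hA, ← Finset.sum_filter]
  conv_rhs => rw [← Finset.sum_toFinset_bitIndices_two_pow n]
  refine Finset.sum_congr ?_ fun _ _ => rfl
  ext i
  simp only [Finset.mem_filter, Finset.mem_range, List.mem_toFinset, Nat.mem_bitIndices,
    and_iff_right_iff_imp]
  intro hi
  by_contra! h
  rw [Nat.testBit_lt_two_pow (hn.trans_le (Nat.pow_le_pow_right two_pos h))] at hi
  exact absurd hi (by simp)

theorem enc_add_enc_injective {d : ℕ} {A : Finset ℕ} (hA : A ⊆ Finset.range d) :
    Function.Injective fun c : (A → Fin 2) × (↥(Finset.range d \ A) → Fin 2) =>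
      enc A c.1 + enc (Finset.range d \ A) c.2 := by
  let g : (A → Fin 2) × (↥(Finset.range d \ A) → Fin 2) → Fin (2 ^ d) :=
    fun c => ⟨_, enc_add_enc_lt hA c.1 c.2⟩
  have hg : Function.Bijective g := by
    rw [Fintype.bijective_iff_surjective_and_card]
    constructor
    · rintro ⟨n, hn⟩
      obtain ⟨x, y, h⟩ := exists_enc_add_enc_eq hA hn
      exact ⟨(x, y), Fin.ext h⟩
    · have := Finset.card_sdiff_add_card_eq_card hA
      simp only [Fintype.card_prod, Fintype.card_fun, Fintype.card_fin, Fintype.card_coe]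
      rw [← pow_add, add_comm, this, Finset.card_range]
  exact fun c c' h => hg.1 (Fin.ext h)

/-- The primes in the interval `(N / 3, N]`. -/
def largePrimes (N : ℕ) : Finset ℕ := {p ∈ Finset.Icc 0 N | p.Prime ∧ N < 3 * p}

theorem theta_le_theta_add_card_largePrimes (N : ℕ) :
    Chebyshev.theta N ≤
      Chebyshev.theta (N / 3 : ℝ) + (largePrimes N).card * Real.log N := by
  have hfloor : ⌊(N / 3 : ℝ)⌋₊ = N / 3 := by
    exact_mod_cast Nat.floor_div_natCast (N : ℝ) 3 |>.trans (by simp)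
  rw [Chebyshev.theta_eq_sum_Icc, Chebyshev.theta_eq_sum_Icc, hfloor, Nat.floor_natCast,
    ← Finset.sum_filter_not_add_sum_filter _ fun p => N < 3 * p]
  refine add_le_add (Finset.sum_le_sum_of_subset_of_nonneg ?_ ?_) ?_
  · intro p hp
    simp only [Finset.mem_filter, Finset.mem_Icc] at hp ⊢
    refine ⟨⟨by omega, by omega⟩, hp.1.2⟩
  · intro p _ _
    exact Real.log_natCast_nonneg p
  · rw [Finset.filter_filter, ← nsmul_eq_mul]
    refine Finset.sum_le_card_nsmul _ _ _ fun p hp => ?_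
    simp only [Finset.mem_filter, Finset.mem_Icc] at hp
    exact Real.log_le_log (by exact_mod_cast hp.2.1.pos) (by exact_mod_cast hp.1.2)

theorem two_pow_le_card_largePrimes (d : ℕ) :
    (2 : ℝ) ^ d / 3 ≤ (d + 1) + 2 * d * √(2 ^ d) + d * (largePrimes (2 ^ d)).card := by
  have hlog : 0 < Real.log 2 := Real.log_pos one_lt_two
  have h₁ := theta_le_theta_add_card_largePrimes (2 ^ d)
  have h₂ := Chebyshev.theta_ge (2 ^ d)
  have h₃ := Chebyshev.theta_le_log4_mul_x (x := ((2 ^ d : ℕ) : ℝ) / 3) (by positivity)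
  have h₄ : Real.log (((2 ^ d : ℕ) : ℝ) + 1) ≤ (d + 1) * Real.log 2 := by
    rw [← Nat.cast_succ d, ← Real.log_pow]
    refine Real.log_le_log (by positivity) ?_
    have : (1 : ℝ) ≤ 2 ^ d := one_le_pow₀ one_le_two
    push_cast
    rw [pow_succ]
    linarith
  have h₅ : Real.log 4 = 2 * Real.log 2 := by
    rw [show (4 : ℝ) = 2 ^ 2 by norm_num, Real.log_pow]
    norm_num
  push_cast at h₁ h₂ h₃ h₄
  rw [Real.log_pow] at h₁ h₂
  rw [h₅] at h₃
  refine le_of_mul_le_mul_right ?_ hlog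
  linarith

theorem eventually_card_largePrimes_ge :
    ∀ᶠ d : ℕ in Filter.atTop,
      2 * (2 : ℝ) ^ ((11 / 12 : ℝ) * d) ≤ (largePrimes (2 ^ d)).card := by
  have hr : 1 < (2 : ℝ) ^ (1 / 12 : ℝ) := Real.one_lt_rpow one_lt_two (by norm_num)
  have hlim := tendsto_pow_const_div_const_pow_of_one_lt 1 hr
  filter_upwards [hlim.eventually (gt_mem_nhds (show (0 : ℝ) < 1 / 18 by norm_num)),
    Filter.eventually_ge_atTop 1] with d hd hd1
  have hd1' : (1 : ℝ) ≤ d := by exact_mod_cast hd1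
  rw [pow_one, div_lt_iff₀ (by positivity), ← Real.rpow_mul_natCast two_pos.le] at hd
  set u := (2 : ℝ) ^ ((11 / 12 : ℝ) * d) with hu
  have hu1 : 1 ≤ u := Real.one_le_rpow one_le_two (by positivity)
  have hmul : (2 : ℝ) ^ d = (2 : ℝ) ^ ((1 / 12 : ℝ) * d) * u := by
    rw [hu, ← Real.rpow_add two_pos, ← Real.rpow_natCast]
    ring_nf
  have hsqrt : √((2 : ℝ) ^ d) ≤ u := by
    rw [Real.sqrt_eq_rpow, ← Real.rpow_natCast_mul two_pos.le, hu]
    exact Real.rpow_le_rpow_of_exponent_le one_le_two (by linarith)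
  have h := two_pow_le_card_largePrimes d
  have h18 : 18 * d * u ≤ (2 : ℝ) ^ d := by
    rw [hmul]
    exact mul_le_mul_of_nonneg_right (by linarith) (by linarith)
  have hdu : (d : ℝ) ≤ d * u := le_mul_of_one_le_right (by linarith) hu1
  have hds : d * √((2 : ℝ) ^ d) ≤ d * u := mul_le_mul_of_nonneg_left hsqrt (by linarith)
  refine le_of_mul_le_mul_left ?_ (show (0 : ℝ) < d by linarith)
  linarith

/-- Square roots of the large primes among the radicands yield the rank bound. -/
theorem card_largePrimes_le_rank_mul {d : ℕ} (hd : 3 ≤ d) {A : Finset ℕ}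
    (hA : A ⊆ Finset.range d)
    (F : (A → Fin 2) → (↥(Finset.range d \ A) → Fin 2) → ℝ)
    (hF : ∀ x y, F x y ^ 2 = ((enc A x + enc (Finset.range d \ A) y + 1 : ℕ) : ℝ)) :
    (largePrimes (2 ^ d)).card ≤
      (Matrix.of F).rank * (2 ^ A.card + 2 ^ (Finset.range d \ A).card) := by
  classical
  let v : (A → Fin 2) × (↥(Finset.range d \ A) → Fin 2) → ℕ :=
    fun c => enc A c.1 + enc (Finset.range d \ A) c.2 + 1
  have hv : Function.Injective v := fun c c' h =>
    enc_add_enc_injective hA (Nat.succ_injective h)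
  let P := Finset.univ.filter fun c => v c ∈ largePrimes (2 ^ d)
  have hP : (largePrimes (2 ^ d)).card ≤ P.card := by
    refine le_trans (Finset.card_le_card fun p hp => ?_) (Finset.card_image_le (f := v))
    have hp' := hp
    simp only [largePrimes, Finset.mem_filter, Finset.mem_Icc] at hp'
    have := hp'.2.1.pos
    obtain ⟨x, y, hxy⟩ := exists_enc_add_enc_eq hA (n := p - 1) (by omega)
    have hvp : v (x, y) = p := by simp only [v]; omega
    exact Finset.mem_image.2 ⟨(x, y), by simpa [P, hvp] using hp, hvp⟩
  obtain ⟨T, hTP, hT, hcard⟩ := exists_matching_s11 P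
  have h8 : 2 ^ 3 ≤ 2 ^ d := Nat.pow_le_pow_right two_pos hd
  have hTprime : ∀ t ∈ T, (v t).Prime ∧ 2 ^ d < 3 * v t := fun t ht => by
    have := hTP ht
    simp only [P, largePrimes, Finset.mem_filter] at this
    exact this.2.2
  have heven : ∀ t ∈ T, Even (enc A t.1) ∧ Even (enc (Finset.range d \ A) t.2) := by
    intro t ht
    obtain ⟨hp, hlt⟩ := hTprime t ht
    have hodd : Odd (v t) := hp.odd_of_ne_two (by omega)
    have hsum : Even (enc A t.1 + enc (Finset.range d \ A) t.2) := by
      simpa [v, Nat.odd_add_one] using hodd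
    by_cases h0 : 0 ∈ A
    · have h := even_enc_of_zero_notMem (A := Finset.range d \ A) (by simp [h0]) t.2
      exact ⟨(Nat.even_add.1 hsum).2 h, h⟩
    · have h := even_enc_of_zero_notMem h0 t.1
      exact ⟨h, (Nat.even_add.1 hsum).1 h⟩
  let e : Fin T.card ≃ T := T.equivFin.symm
  let M := (Matrix.of F).submatrix (fun i => (e i).1.1) fun j => (e j).1.2
  have hdet : M.det ≠ 0 := by
    refine det_ne_zero_of_sq_eq_natCast M (fun i j => v ((e i).1.1, (e j).1.2))
      (fun i j => hF _ _) (fun i => (hTprime _ (e i).2).1) fun i j k hdvd => ?_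
    obtain ⟨_, hlt⟩ := hTprime _ (e i).2
    have hle : v ((e j).1.1, (e k).1.2) ≤ 2 ^ d := enc_add_enc_lt hA _ _
    have hj := (heven _ (e j).2).1
    have hk := (heven _ (e k).2).2
    obtain ⟨m, hm : v ((e j).1.1, (e k).1.2) = v (e i).1 * m⟩ := hdvd
    have hm3 : m < 3 := by
      by_contra! h
      have := Nat.mul_le_mul_left (v (e i).1) h
      omega
    have hodd : Odd (v ((e j).1.1, (e k).1.2)) := (hj.add hk).add_one
    have hm1 : m = 1 := by
      rw [hm, Nat.odd_mul] at hodd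
      obtain ⟨q, hq⟩ := hodd.2
      omega
    rw [hm1, mul_one] at hm
    have hcell := hv hm
    have hfst := congrArg Prod.fst hcell
    have hsnd := congrArg Prod.snd hcell
    exact ⟨e.injective (Subtype.ext (hT _ (e j).2 _ (e i).2 (Or.inl hfst))),
      e.injective (Subtype.ext (hT _ (e k).2 _ (e i).2 (Or.inr hsnd)))⟩
  have hrank : T.card ≤ (Matrix.of F).rank := by
    have h := Matrix.rank_of_isUnit M ((Matrix.isUnit_iff_isUnit_det M).2 hdet.isUnit)
    rw [Fintype.card_fin] at h
    exact h ▸ Matrix.rank_submatrix_le _ _ _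
  refine (hP.trans hcard).trans ?_
  simp only [Fintype.card_fun, Fintype.card_fin, Fintype.card_coe]
  exact Nat.mul_le_mul_right _ hrank

/-- for 0 < ε < 1/4 and sufficiently large d, for any A ⊆ {0,…,d−1} with
d/3 ≤ |A| ≤ 2d/3 and B its complement, any real-valued F on pairs of assignments with
F(x,y)² = ι_A(x) + ι_B(y) + 1 yields a matrix of rank at least 2^{(1/4−ε)d}. -/
theorem stmt_11 :
    ∀ ε : ℝ, 0 < ε → ε < 1/4 →
    ∃ d₀ : ℕ, ∀ d : ℕ, d₀ ≤ d →
    ∀ A : Finset ℕ, A ⊆ Finset.range d →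
      (d : ℝ) / 3 ≤ (A.card : ℝ) → (A.card : ℝ) ≤ 2 * (d : ℝ) / 3 →
    ∀ B : Finset ℕ, B = Finset.range d \ A →
    ∀ F : (A → Fin 2) → (B → Fin 2) → ℝ,
      (∀ x y, (F x y) ^ 2 = ((enc A x + enc B y + 1 : ℕ) : ℝ)) →
      (2 : ℝ) ^ ((1/4 - ε) * d) ≤ ((Matrix.of F).rank : ℝ) := by
  intro ε hε _
  obtain ⟨d₀, hd₀⟩ := Filter.eventually_atTop.1
    (eventually_card_largePrimes_ge.and (Filter.eventually_ge_atTop 3))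
  refine ⟨d₀, fun d hd A hA hAlow hAhigh B hB F hF => ?_⟩
  subst hB
  obtain ⟨hQ, hd3⟩ := hd₀ d hd
  have hBcard : ((Finset.range d \ A).card : ℝ) + A.card = d := by
    have := Finset.card_sdiff_add_card_eq_card hA
    rw [Finset.card_range] at this
    exact_mod_cast this
  have hside : ∀ k : ℕ, (k : ℝ) ≤ 2 * d / 3 → (2 : ℝ) ^ k ≤ 2 ^ (2 * (d : ℝ) / 3) := by
    intro k hk
    rw [← Real.rpow_natCast]
    exact Real.rpow_le_rpow_of_exponent_le one_le_two hk
  have hA' := hside _ hAhigh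
  have hB' := hside (Finset.range d \ A).card (by linarith)
  have hrank : ((largePrimes (2 ^ d)).card : ℝ) ≤
      (Matrix.of F).rank * (2 ^ A.card + 2 ^ (Finset.range d \ A).card) := by
    exact_mod_cast card_largePrimes_le_rank_mul hd3 hA F hF
  have hsplit : (2 : ℝ) ^ ((11 / 12 : ℝ) * d) =
      2 ^ ((1 / 4 : ℝ) * d) * 2 ^ (2 * (d : ℝ) / 3) := by
    rw [← Real.rpow_add two_pos]
    ring_nf
  have hexp : (2 : ℝ) ^ ((1 / 4 - ε) * d) ≤ 2 ^ ((1 / 4 : ℝ) * d) :=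
    Real.rpow_le_rpow_of_exponent_le one_le_two
      (mul_le_mul_of_nonneg_right (by linarith) (Nat.cast_nonneg d))
  refine hexp.trans ?_
  have hpos : (0 : ℝ) < 2 ^ (2 * (d : ℝ) / 3) := by positivity
  refine le_of_mul_le_mul_right ?_ hpos
  have := mul_le_mul_of_nonneg_left (add_le_add hA' hB')
    (Nat.cast_nonneg (α := ℝ) (Matrix.of F).rank)
  linarith
end
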